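/- Let G₁ be an OE-group and H, K finite subgroups of G₁, and let f, f₁ ∈ Iso(H,K). Then HNN(G₁,H,K,f) and HNN(G₁,H,K,f₁) are isomorphic if and only if f and f₁ lie in the same Γ̄_{HK}-orbit of Iso(H,K), i.e., there exists σ ∈ Γ̄_{HK} with σ(f) = f₁. -/

import Mathlib

universe u w

/-- The restriction to a subgroup `H` of an automorphism of `G` that leaves `H`
invariant. -/
def restrAut {G : Type u} [Group G] (H : Subgroup G) (α : G ≃* G)
    (hα : ∀ x : G, x ∈ H ↔ α x ∈ H) : H ≃* H where
  toFun x := ⟨α x, (hα x).mp x.2⟩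
  invFun x := ⟨α.symm x, (hα _).mpr (by simp)⟩
  left_inv x := by ext; simp
  right_inv x := by ext; simp
  map_mul' x y := by ext; simp

/-- The automorphism `x ↦ g·α(x)·g⁻¹` of a subgroup `K` invariant under it. -/
def conjAut {G : Type u} [Group G] (K : Subgroup G) (g : G) (α : G ≃* G)
    (hK : ∀ x : G, x ∈ K ↔ g * α x * g⁻¹ ∈ K) : K ≃* K where
  toFun x := ⟨g * α x * g⁻¹, (hK x).mp x.2⟩
  invFun x := ⟨α.symm (g⁻¹ * x * g), (hK _).mpr (by simp [mul_assoc])⟩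
  left_inv x := by ext; simp [mul_assoc]
  right_inv x := by ext; simp [mul_assoc]
  map_mul' x y := by ext; simp [mul_assoc]

/-- The permutation of `Iso(H,K)` induced by an element `(g,α)` of `Γ_{HK}`, i.e. a pair
with `α(H) = H` and `g·α(K)·g⁻¹ = K`.  It sends `f` to `h ↦ g·α(f(α⁻¹(h)))·g⁻¹`. -/
def gammaPerm {G : Type u} [Group G] (H K : Subgroup G) (g : G) (α : G ≃* G)
    (hα : ∀ x : G, x ∈ H ↔ α x ∈ H)
    (hK : ∀ x : G, x ∈ K ↔ g * α x * g⁻¹ ∈ K) : Equiv.Perm (H ≃* K) where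
  toFun f := ((restrAut H α hα).symm.trans f).trans (conjAut K g α hK)
  invFun f := ((restrAut H α hα).trans f).trans (conjAut K g α hK).symm
  left_inv f := by ext x; simp
  right_inv f := by ext x; simp

/-- `Γ̃_{HK}`: the image in `Sym(Iso(H,K))` of the stabilizer `Γ_{HK}`, i.e. the set of the
permutations `gammaPerm` induced by pairs `(g,α)` with `α(H) = H` and `g·α(K)·g⁻¹ = K`. -/
def gammaTildeSet {G : Type u} [Group G] (H K : Subgroup G) : Set (Equiv.Perm (H ≃* K)) :=
  {σ | ∃ (g : G) (α : G ≃* G) (hα : ∀ x : G, x ∈ H ↔ α x ∈ H)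
      (hK : ∀ x : G, x ∈ K ↔ g * α x * g⁻¹ ∈ K), σ = gammaPerm H K g α hα hK}

/-- The isomorphism `H ≃ K` obtained by restricting an automorphism `ψ` of `G` with
`ψ(H) = K`. -/
def restrMap {G : Type u} [Group G] (H K : Subgroup G) (ψ : G ≃* G)
    (h1 : ∀ x : G, x ∈ H ↔ ψ x ∈ K) : H ≃* K where
  toFun x := ⟨ψ x, (h1 x).mp x.2⟩
  invFun y := ⟨ψ.symm y, (h1 _).mpr (by simp)⟩
  left_inv x := by ext; simp
  right_inv y := by ext; simp
  map_mul' x y := by ext; simp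

/-- The isomorphism `H ≃ K`, `x ↦ ψ⁻¹(g₁⁻¹·x·g₁)`, coming from swapping data `(ψ,g₁)`
(where `ψ(K) = g₁⁻¹·H·g₁`, i.e. `∀ x, x ∈ K ↔ g₁·ψ(x)·g₁⁻¹ ∈ H`). -/
def dMap {G : Type u} [Group G] (H K : Subgroup G) (ψ : G ≃* G) (g₁ : G)
    (h2 : ∀ x : G, x ∈ K ↔ g₁ * ψ x * g₁⁻¹ ∈ H) : H ≃* K where
  toFun x := ⟨ψ.symm (g₁⁻¹ * x * g₁), (h2 _).mpr (by simp [mul_assoc])⟩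
  invFun y := ⟨g₁ * ψ y * g₁⁻¹, (h2 _).mp y.2⟩
  left_inv x := by ext; simp [mul_assoc]
  right_inv y := by ext; simp [mul_assoc]
  map_mul' x y := by ext; simp [mul_assoc]

/-- The permutation `ι_{ψ,g₁}` of `Iso(H,K)` attached to swapping data `(ψ,g₁)` for `(H,K)`
(i.e. `ψ(H) = K` and `ψ(K) = g₁⁻¹·H·g₁`): it sends `f` to
`h ↦ ψ⁻¹(g₁⁻¹·f⁻¹(ψ(h))·g₁)`. -/
def iotaPerm {G : Type u} [Group G] (H K : Subgroup G) (ψ : G ≃* G) (g₁ : G)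
    (h1 : ∀ x : G, x ∈ H ↔ ψ x ∈ K)
    (h2 : ∀ x : G, x ∈ K ↔ g₁ * ψ x * g₁⁻¹ ∈ H) : Equiv.Perm (H ≃* K) where
  toFun f := ((restrMap H K ψ h1).trans f.symm).trans (dMap H K ψ g₁ h2)
  invFun f := ((dMap H K ψ g₁ h2).trans f.symm).trans (restrMap H K ψ h1)
  left_inv f := by ext x; simp
  right_inv f := by ext x; simp

/-- A group has the tree fixed-point property if every action of it without inversions
(given by a homomorphism to the permutations of the vertices preserving adjacency) on a
tree (a nonempty connected acyclic simple graph) in which all edge stabilizers are finite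
fixes a vertex. -/
def TreeFixedPointProperty (Γ : Type*) [Group Γ] : Prop :=
  ∀ (V : Type w) (T : SimpleGraph V), T.IsTree →
    ∀ ρ : Γ →* Equiv.Perm V,
      (∀ (g : Γ) (x y : V), T.Adj x y → T.Adj (ρ g x) (ρ g y)) →
      (¬ ∃ (g : Γ) (x y : V), T.Adj x y ∧ ρ g x = y ∧ ρ g y = x) →
      (∀ x y : V, T.Adj x y → Set.Finite {g : Γ | ρ g x = x ∧ ρ g y = y}) →
      ∃ v : V, ∀ g : Γ, ρ g v = v

/-- A group is residually finite if every nontrivial element is nontrivial in some finite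
quotient. -/
def ResiduallyFinite (G : Type*) [Group G] : Prop :=
  ∀ g : G, g ≠ 1 → ∃ (Q : Type) (_ : Group Q), Finite Q ∧ ∃ φ : G →* Q, φ g ≠ 1

/-- An OE-group: a finitely generated, residually finite group with the tree fixed-point
property. -/
def IsOEGroup (Γ : Type*) [Group Γ] : Prop :=
  Group.FG Γ ∧ ResiduallyFinite Γ ∧ TreeFixedPointProperty.{w} Γ

/-- The set of permutations `ι_{ψ,g₁}` of `Iso(H,K)` for all swapping data `(ψ,g₁)`
for `(H,K)`. -/
def iotaSet {G : Type u} [Group G] (H K : Subgroup G) : Set (Equiv.Perm (H ≃* K)) :=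
  {σ | ∃ (ψ : G ≃* G) (g₁ : G) (h1 : ∀ x : G, x ∈ H ↔ ψ x ∈ K)
      (h2 : ∀ x : G, x ∈ K ↔ g₁ * ψ x * g₁⁻¹ ∈ H), σ = iotaPerm H K ψ g₁ h1 h2}

/-- `Γ̄_{HK}`: the subgroup of `Sym(Iso(H,K))` generated by `Γ̃_{HK}` together with the
permutations `ι_{ψ,g₁}` for all swapping data `(ψ,g₁)` for `(H,K)`. -/
def gammaBar {G : Type u} [Group G] (H K : Subgroup G) : Subgroup (Equiv.Perm (H ≃* K)) :=
  Subgroup.closure (gammaTildeSet H K ∪ iotaSet H K)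

/-! ### Common suffixes of lists -/

namespace List

variable {α : Type*}

open Classical in
/-- The length of the longest common prefix of two lists. -/
noncomputable def commonPrefixLength : List α → List α → ℕ
  | a :: l, b :: l' => if a = b then commonPrefixLength l l' + 1 else 0
  | _, _ => 0

theorem commonPrefixLength_self (l : List α) : commonPrefixLength l l = l.length := by
  induction l with
  | nil => rfl
  | cons a l ih => simp [commonPrefixLength, ih]

theorem commonPrefixLength_comm (l l' : List α) :
    commonPrefixLength l l' = commonPrefixLength l' l := by
  induction l generalizing l' with
  | nil => cases l' <;> rfl
  | cons a l ih =>
    cases l' with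
    | nil => rfl
    | cons b l' => simp only [commonPrefixLength, ih l']; split_ifs <;> simp_all

theorem commonPrefixLength_le (l l' : List α) : commonPrefixLength l l' ≤ l.length := by
  induction l generalizing l' with
  | nil => simp [commonPrefixLength]
  | cons a l ih =>
    cases l' with
    | nil => simp [commonPrefixLength]
    | cons b l' =>
      simp only [commonPrefixLength]
      have := ih l'
      split_ifs <;> simp_all

theorem min_commonPrefixLength_le (l l' l'' : List α) :
    min (commonPrefixLength l l') (commonPrefixLength l' l'') ≤ commonPrefixLength l l'' := by
  induction l generalizing l' l'' with
  | nil => simp [commonPrefixLength]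
  | cons a l ih =>
    rcases l' with _ | ⟨b, l'⟩ <;> rcases l'' with _ | ⟨c, l''⟩ <;> try simp [commonPrefixLength]
    have := ih l' l''
    split_ifs <;> simp_all

theorem commonPrefixLength_append_singleton_le (l l' : List α) (a : α) :
    commonPrefixLength l l' ≤ commonPrefixLength (l ++ [a]) l' ∧
      commonPrefixLength (l ++ [a]) l' ≤ commonPrefixLength l l' + 1 := by
  induction l generalizing l' with
  | nil =>
    rcases l' with _ | ⟨c, l'⟩ <;> simp [commonPrefixLength]
    split_ifs <;> simp
  | cons b l ih =>
    rcases l' with _ | ⟨c, l'⟩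
    · simp [commonPrefixLength]
    · have := ih l'
      simp only [cons_append, commonPrefixLength]
      split_ifs <;> simp_all

theorem commonPrefixLength_append_singleton (l l' : List α) (a : α)
    (hlen : l'.length ≤ (l ++ [a]).length) (hne : l ++ [a] ≠ l') :
    commonPrefixLength (l ++ [a]) l' = commonPrefixLength l l' := by
  induction l generalizing l' with
  | nil =>
    rcases l' with _ | ⟨c, l'⟩ <;> simp_all [commonPrefixLength]
  | cons b l ih =>
    rcases l' with _ | ⟨c, l'⟩
    · simp [commonPrefixLength]
    · simp only [cons_append, commonPrefixLength]
      split_ifs with h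
      · subst h
        rw [ih l' (by simpa using hlen) (by simpa using hne)]
      · rfl

/-- The length of the longest common suffix of two lists. -/
noncomputable def commonSuffixLength (l l' : List α) : ℕ :=
  commonPrefixLength l.reverse l'.reverse

theorem commonSuffixLength_self (l : List α) : commonSuffixLength l l = l.length := by
  simp [commonSuffixLength, commonPrefixLength_self]

theorem commonSuffixLength_comm (l l' : List α) :
    commonSuffixLength l l' = commonSuffixLength l' l :=
  commonPrefixLength_comm _ _

theorem commonSuffixLength_le (l l' : List α) : commonSuffixLength l l' ≤ l.length := by
  simpa [commonSuffixLength] using commonPrefixLength_le l.reverse l'.reverse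

theorem min_commonSuffixLength_le (l l' l'' : List α) :
    min (commonSuffixLength l l') (commonSuffixLength l' l'') ≤ commonSuffixLength l l'' :=
  min_commonPrefixLength_le _ _ _

theorem commonSuffixLength_cons_le (l l' : List α) (a : α) :
    commonSuffixLength l l' ≤ commonSuffixLength (a :: l) l' ∧
      commonSuffixLength (a :: l) l' ≤ commonSuffixLength l l' + 1 := by
  simpa [commonSuffixLength] using commonPrefixLength_append_singleton_le l.reverse l'.reverse a

theorem commonSuffixLength_cons (l l' : List α) (a : α)
    (hlen : l'.length ≤ (a :: l).length) (hne : a :: l ≠ l') :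
    commonSuffixLength (a :: l) l' = commonSuffixLength l l' := by
  rw [commonSuffixLength, reverse_cons]
  refine commonPrefixLength_append_singleton l.reverse l'.reverse a (by simpa using hlen) ?_
  rw [← reverse_cons]
  exact fun h ↦ hne (reverse_injective h)

end List

/-! ### The tree of suffix-closed sets of lists -/

/-- The graph on a set of lists in which every nonempty list is joined to its tail. -/
def suffixGraph {α : Type*} (S : Set (List α)) : SimpleGraph S where
  Adj l l' := ∃ a, l'.1 = a :: l.1 ∨ l.1 = a :: l'.1
  symm := ⟨fun _ _ ⟨a, h⟩ ↦ ⟨a, h.symm⟩⟩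
  loopless := ⟨fun _ ⟨a, h⟩ ↦ by rcases h with h | h <;> simpa using congrArg List.length h⟩

theorem suffixGraph_isTree {α : Type*} {S : Set (List α)} (hnil : [] ∈ S)
    (htail : ∀ a l, a :: l ∈ S → l ∈ S) : (suffixGraph S).IsTree where
  connected := by
    rw [SimpleGraph.connected_iff_exists_forall_reachable]
    refine ⟨⟨[], hnil⟩, ?_⟩
    rintro ⟨l, hl⟩
    induction l with
    | nil => exact SimpleGraph.Reachable.refl _
    | cons a l ih =>
      exact (ih (htail a l hl)).trans (SimpleGraph.Adj.reachable ⟨a, Or.inl rfl⟩)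
  isAcyclic := by
    classical
    intro v c hc
    obtain ⟨w, hw, hmax⟩ := c.support.toFinset.exists_max_image (fun l ↦ l.1.length)
      ⟨v, by simp⟩
    simp only [List.mem_toFinset] at hw hmax
    have hc' := hc.rotate hw
    have hle : ∀ x ∈ (c.rotate w hw).support, x.1.length ≤ w.1.length := fun x hx ↦
      hmax x (by simpa using hx)
    have key : ∀ x ∈ (c.rotate w hw).support, (suffixGraph S).Adj w x → x.1 = w.1.tail := by
      rintro x hx ⟨a, h | h⟩
      · have := hle x hx
        simp [h] at this
      · simp [h]
    refine hc'.snd_ne_penultimate (Subtype.ext ?_)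
    rw [key _ (SimpleGraph.Walk.getVert_mem_support _ _) (SimpleGraph.Walk.adj_snd hc'.not_nil),
      key _ (SimpleGraph.Walk.getVert_mem_support _ _)
        (SimpleGraph.Walk.adj_penultimate hc'.not_nil).symm]

theorem TreeFixedPointProperty.exists_fixed {Γ : Type*} [Group Γ]
    (hΓ : TreeFixedPointProperty.{w} Γ) {V : Type*} [Small.{w} V] {T : SimpleGraph V}
    (hT : T.IsTree) (ρ : Γ →* Equiv.Perm V)
    (hadj : ∀ (g : Γ) (x y : V), T.Adj x y → T.Adj (ρ g x) (ρ g y))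
    (hinv : ¬ ∃ (g : Γ) (x y : V), T.Adj x y ∧ ρ g x = y ∧ ρ g y = x)
    (hfin : ∀ x y : V, T.Adj x y → Set.Finite {g : Γ | ρ g x = x ∧ ρ g y = y}) :
    ∃ v : V, ∀ g : Γ, ρ g v = v := by
  let e := equivShrink.{w} V
  obtain ⟨v, hv⟩ := hΓ (Shrink.{w} V) (T.comap e.symm)
    ((SimpleGraph.Iso.comap e.symm T).isTree_iff.2 hT)
    (e.permCongrHom.toMonoidHom.comp ρ)
    (fun g x y h ↦ by simpa [Equiv.permCongrHom] using hadj g _ _ h)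
    (by
      rintro ⟨g, x, y, h, hx, hy⟩
      refine hinv ⟨g, e.symm x, e.symm y, h, ?_, ?_⟩
      · rw [← hx]; simp [Equiv.permCongrHom]
      · rw [← hy]; simp [Equiv.permCongrHom])
    (fun x y h ↦ (hfin _ _ h).subset fun g hg ↦ by
      simpa [Equiv.permCongrHom, ← Equiv.eq_symm_apply] using hg)
  exact ⟨e.symm v, fun g ↦ by simpa [Equiv.permCongrHom, ← Equiv.eq_symm_apply] using hv g⟩

theorem Group.FG.countable {G : Type*} [Group G] (h : Group.FG G) : Countable G := by
  obtain ⟨α, _, φ, hφ⟩ := Group.fg_iff_exists_freeGroup_hom_surjective_finite.1 h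
  exact hφ.countable
/-! ### The length function of an HNN-extension -/

namespace HNNExtension

variable {G : Type*} [Group G] {A B : Subgroup G} {φ : A ≃* B}

open NormalWord

/-- The list of letters of the normal form of an element of an HNN-extension, with respect to a
fixed choice of transversals.  It determines the element up to left multiplication by `G`. -/
noncomputable def letters (x : HNNExtension G A B φ) : List (ℤˣ × G) :=
  (x • (empty : NormalWord (Classical.arbitrary (TransversalPair G A B)))).toList

/-- The number of occurrences of the stable letter in the normal form of an element. -/
noncomputable def len (x : HNNExtension G A B φ) : ℕ := x.letters.length

@[simp]
theorem letters_one : letters (1 : HNNExtension G A B φ) = [] := by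
  simp [letters]

@[simp]
theorem letters_of_mul (g : G) (x : HNNExtension G A B φ) : letters (of g * x) = letters x := by
  simp [letters, mul_smul, of_smul_eq_smul]

theorem exists_eq_of_mul_of_letters_eq {x y : HNNExtension G A B φ} (h : letters x = letters y) :
    ∃ g, x = of g * y := by
  set d := Classical.arbitrary (TransversalPair G A B)
  set w := x • (empty : NormalWord d) with hw
  set w' := y • (empty : NormalWord d) with hw'
  refine ⟨w.head * w'.head⁻¹, (NormalWord.equiv φ d).injective ?_⟩
  change x • (empty : NormalWord d) = (of (w.head * w'.head⁻¹) * y) • (empty : NormalWord d)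
  rw [mul_smul, of_smul_eq_smul, ← hw, ← hw']
  ext1
  · simp
  · exact h

theorem letters_t_zpow_mul (u : ℤˣ) (x : HNNExtension G A B φ) :
    (∃ a, letters x = a :: letters (t ^ (u : ℤ) * x)) ∨
      ∃ a, letters (t ^ (u : ℤ) * x) = a :: letters x := by
  set d := Classical.arbitrary (TransversalPair G A B)
  have h : letters (t ^ (u : ℤ) * x) = (unitsSMul φ u (x • (empty : NormalWord d))).toList := by
    rw [letters, mul_smul, t_pow_smul_eq_unitsSMul]
  have h' : letters x = (x • (empty : NormalWord d)).toList := rfl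
  rw [h, h']
  generalize x • (empty : NormalWord d) = w
  rw [unitsSMul]
  split_ifs with hc
  · left
    cases w using consRecOn with
    | ofGroup => simp [Cancels] at hc
    | cons g u' w h1 h2 _ => exact ⟨(u', w.head), by simp [unitsSMulWithCancel]⟩
  · right
    exact ⟨(u, _), rfl⟩

theorem exists_of_letters_eq_cons {x : HNNExtension G A B φ} {a : ℤˣ × G} {l : List (ℤˣ × G)}
    (h : letters x = a :: l) :
    ∃ (y : HNNExtension G A B φ) (g : G) (u : ℤˣ),
      letters y = l ∧ x = of g * (t ^ (u : ℤ) * y) := by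
  set d := Classical.arbitrary (TransversalPair G A B)
  have hx : (x • (empty : NormalWord d)).prod φ = x := by simp
  have h' : (x • (empty : NormalWord d)).toList = a :: l := h
  generalize x • (empty : NormalWord d) = w at hx h'
  cases w using consRecOn with
  | ofGroup => simp at h'
  | cons g u w h1 h2 _ =>
    refine ⟨w.prod φ, g, u, ?_, by rw [← hx, prod_cons]⟩
    rw [letters, prod_smul_empty]
    simp only [cons_toList, List.cons.injEq] at h'
    exact h'.2

theorem letters_eq_nil_iff {x : HNNExtension G A B φ} : letters x = [] ↔ ∃ g, of g = x := by
  constructor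
  · intro h
    obtain ⟨g, hg⟩ := exists_eq_of_mul_of_letters_eq (h.trans letters_one.symm)
    exact ⟨g, by simp [hg]⟩
  · rintro ⟨g, rfl⟩
    simpa using letters_of_mul (φ := φ) g 1

theorem len_eq_zero_iff {x : HNNExtension G A B φ} : len x = 0 ↔ ∃ g, of g = x := by
  rw [len, List.length_eq_zero_iff, letters_eq_nil_iff]

/-- The length of the common suffix of the normal forms of two elements. -/
noncomputable def common (x y : HNNExtension G A B φ) : ℕ :=
  List.commonSuffixLength x.letters y.letters

theorem common_comm (x y : HNNExtension G A B φ) : common x y = common y x :=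
  List.commonSuffixLength_comm _ _

theorem common_le_left (x y : HNNExtension G A B φ) : common x y ≤ len x :=
  List.commonSuffixLength_le _ _

theorem common_le_right (x y : HNNExtension G A B φ) : common x y ≤ len y := by
  rw [common_comm]; exact common_le_left y x

theorem min_common_le (x y z : HNNExtension G A B φ) :
    min (common x y) (common y z) ≤ common x z :=
  List.min_commonSuffixLength_le _ _ _

theorem len_of_mul (g : G) (x : HNNExtension G A B φ) : len (of g * x) = len x := by
  simp [len]

theorem len_t_zpow_mul_le (u : ℤˣ) (x : HNNExtension G A B φ) :
    len (t ^ (u : ℤ) * x) ≤ len x + 1 := by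
  rcases letters_t_zpow_mul u x with ⟨a, h⟩ | ⟨a, h⟩ <;>
    · have := congrArg List.length h
      simp [len] at this ⊢
      omega

/-- The combinatorial distance of two normal forms is at most the length of the quotient. -/
theorem len_add_len_le (x y : HNNExtension G A B φ) :
    len (x * y) + len y ≤ len x + 2 * common (x * y) y := by
  obtain ⟨l, hl⟩ : ∃ l, letters x = l := ⟨_, rfl⟩
  induction l generalizing x with
  | nil =>
    obtain ⟨g, rfl⟩ := letters_eq_nil_iff.1 hl
    rw [len_of_mul, common, letters_of_mul, List.commonSuffixLength_self]
    simp only [len]; omega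
  | cons a l ih =>
    obtain ⟨x', g, u, hx', rfl⟩ := exists_of_letters_eq_cons hl
    have h1 := ih x' hx'
    have h2 : len (of g * (t ^ (u : ℤ) * x')) = len x' + 1 := by simp [len, hl, hx']
    rw [h2, mul_assoc, len_of_mul, common, letters_of_mul]
    rw [common] at h1
    rw [mul_assoc]
    rcases letters_t_zpow_mul u (x' * y) with ⟨b, h⟩ | ⟨b, h⟩ <;>
      · have h3 := congrArg List.length h
        have h4 := List.commonSuffixLength_cons_le (letters (x' * y)) (letters y) b
        have h5 := List.commonSuffixLength_cons_le
          (letters (t ^ (u : ℤ) * (x' * y))) (letters y) b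
        rw [List.length_cons] at h3
        simp only [← h] at h4 h5
        simp only [len] at h1 ⊢
        omega

theorem len_inv (x : HNNExtension G A B φ) : len x⁻¹ = len x := by
  have key (y : HNNExtension G A B φ) : len y⁻¹ ≤ len y := by
    have h1 := len_add_len_le y y⁻¹
    have h2 := common_le_left (y * y⁻¹) y⁻¹
    have h3 : len (1 : HNNExtension G A B φ) = 0 := len_eq_zero_iff.2 ⟨1, map_one _⟩
    rw [mul_inv_cancel, h3] at h1 h2
    omega
  refine le_antisymm (key x) ?_
  simpa using key x⁻¹

theorem len_mul_inv_le (n : ℕ) (x y : HNNExtension G A B φ) (hn : len x + len y = n) :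
    len (x * y⁻¹) + 2 * common x y ≤ len x + len y := by
  induction n using Nat.strong_induction_on generalizing x y with
  | _ n ih =>
  have main (x y : HNNExtension G A B φ) (hn : len x + len y = n) (hxy : len y ≤ len x) :
      len (x * y⁻¹) + 2 * common x y ≤ len x + len y := by
    by_cases he : letters x = letters y
    · obtain ⟨g, hg⟩ := exists_eq_of_mul_of_letters_eq he
      have : len (x * y⁻¹) = 0 := len_eq_zero_iff.2 ⟨g, by simp [hg]⟩
      have := common_le_left x y
      have := common_le_right x y
      omega
    · obtain ⟨l, hl⟩ : ∃ l, letters x = l := ⟨_, rfl⟩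
      cases l with
      | nil =>
        exfalso
        apply he
        rw [hl]
        simp only [len, hl, List.length_nil, nonpos_iff_eq_zero, List.length_eq_zero_iff] at hxy
        exact hxy.symm
      | cons a l =>
        obtain ⟨x', g, u, hx', rfl⟩ := exists_of_letters_eq_cons hl
        have h2 : len (of g * (t ^ (u : ℤ) * x')) = len x' + 1 := by simp [len, hl, hx']
        have h3 := List.commonSuffixLength_cons l (letters y) a
          (by rw [← hl]; exact hxy) (by rw [← hl]; exact he)
        have h4 := ih (len x' + len y) (by omega) x' y rfl
        have h5 := len_t_zpow_mul_le u (x' * y⁻¹)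
        rw [common, hx'] at h4
        rw [h2, common, hl, h3, mul_assoc, len_of_mul, mul_assoc]
        omega
  rcases le_total (len y) (len x) with h | h
  · exact main x y hn h
  · have := main y x (by omega) h
    rw [← len_inv, mul_inv_rev, inv_inv, common_comm] at this
    omega

/-- The length function is that of a tree: the distance between two vertices is obtained from
their distances to the base vertex and their Gromov product. -/
theorem len_mul_inv (x y : HNNExtension G A B φ) :
    len (x * y⁻¹) + 2 * common x y = len x + len y := by
  have h1 := len_mul_inv_le _ x y rfl
  have h2 := len_add_len_le (x * y⁻¹) y
  rw [inv_mul_cancel_right] at h2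
  omega

theorem len_mul_of (x : HNNExtension G A B φ) (g : G) : len (x * of g) = len x := by
  rw [← len_inv, mul_inv_rev, ← map_inv, len_of_mul, len_inv]

theorem exists_len_eq_one_add {x : HNNExtension G A B φ} (hx : len x ≠ 0) :
    ∃ (y : HNNExtension G A B φ) (g : G) (u : ℤˣ),
      len x = len y + 1 ∧ x = of g * (t ^ (u : ℤ) * y) := by
  obtain ⟨l, hl⟩ : ∃ l, letters x = l := ⟨_, rfl⟩
  cases l with
  | nil => simp [len, hl] at hx
  | cons a l =>
    obtain ⟨y, g, u, hy, h⟩ := exists_of_letters_eq_cons hl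
    exact ⟨y, g, u, by simp [len, hl, hy], h⟩

theorem exists_eq_of_len_eq_one {x : HNNExtension G A B φ} (hx : len x = 1) :
    ∃ (g : G) (u : ℤˣ) (g' : G), x = of g * (t ^ (u : ℤ) * of g') := by
  obtain ⟨y, g, u, hy, rfl⟩ := exists_len_eq_one_add (x := x) (by omega)
  obtain ⟨g', rfl⟩ := len_eq_zero_iff.1 (show len y = 0 by omega)
  exact ⟨g, u, g', rfl⟩

theorem len_t_zpow (u : ℤˣ) : len (t ^ (u : ℤ) : HNNExtension G A B φ) = 1 := by
  have h := letters_t_zpow_mul u (1 : HNNExtension G A B φ)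
  simp only [mul_one, letters_one] at h
  rcases h with ⟨a, h⟩ | ⟨a, h⟩
  · simp at h
  · simp [len, h]

/-- Every element has an initial subword of each smaller length. -/
theorem exists_len_eq {x : HNNExtension G A B φ} {k : ℕ} (hk : k ≤ len x) :
    ∃ z : HNNExtension G A B φ, len z = k ∧ len (x * z⁻¹) + k = len x := by
  obtain ⟨j, hj⟩ := Nat.exists_eq_add_of_le hk
  induction j generalizing x with
  | zero =>
    refine ⟨x, by omega, ?_⟩
    have : len (1 : HNNExtension G A B φ) = 0 := len_eq_zero_iff.2 ⟨1, map_one _⟩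
    rw [mul_inv_cancel]
    omega
  | succ j ih =>
    obtain ⟨y, g, u, hy, rfl⟩ := exists_len_eq_one_add (x := x) (by omega)
    obtain ⟨z, hz, hz'⟩ := ih (x := y) (by omega) (by omega)
    refine ⟨z, hz, ?_⟩
    have h1 := len_mul_inv (of g * (t ^ (u : ℤ) * y)) z
    have h2 := common_le_right (of g * (t ^ (u : ℤ) * y)) z
    have h3 := len_t_zpow_mul_le u (y * z⁻¹)
    rw [← mul_assoc, ← len_of_mul g] at h3
    simp only [mul_assoc] at h1 h3 ⊢
    omega

/-- The homomorphism to `ℤ` counting occurrences of the stable letter. -/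
def exponent : HNNExtension G A B φ →* Multiplicative ℤ :=
  lift 1 (Multiplicative.ofAdd 1) (by simp)

@[simp]
theorem exponent_of (g : G) : exponent (of g : HNNExtension G A B φ) = 1 := by
  simp [exponent]

@[simp]
theorem exponent_t : exponent (t : HNNExtension G A B φ) = Multiplicative.ofAdd 1 := by
  simp [exponent]
theorem mem_toSubgroup_of_t_zpow_conj {u : ℤˣ} {g : G}
    (h : len (t ^ (u : ℤ) * of g * (t ^ (u : ℤ))⁻¹ : HNNExtension G A B φ) = 0) :
    g ∈ toSubgroup A B u := by
  by_contra hg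
  obtain ⟨k, hk⟩ := len_eq_zero_iff.1 h
  let w : ReducedWord G A B :=
    { head := 1
      toList := [(u, g), (-u, 1)]
      chain := by simp [hg] }
  have := ReducedWord.toList_eq_nil_of_mem_of_range φ w
    ⟨k, by simp [hk, w, ReducedWord.prod, mul_assoc]⟩
  simp [w] at this

theorem of_toSubgroupEquiv (u : ℤˣ) (a : toSubgroup A B u) :
    t ^ (u : ℤ) * of (a : G) * (t ^ (u : ℤ))⁻¹ =
      (of (toSubgroupEquiv φ u a : G) : HNNExtension G A B φ) := by
  rcases Int.units_eq_one_or u with rfl | rfl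
  · have := equiv_eq_conj (φ := φ) a
    simp only [Units.val_one, zpow_one]
    exact this.symm
  · have := equiv_symm_eq_conj (φ := φ) a
    simp only [Units.val_neg, Units.val_one, zpow_neg, zpow_one, inv_inv]
    exact this.symm

/-- The elements of `G` whose conjugates by `x` lie in `G`. -/
def stab (x : HNNExtension G A B φ) : Subgroup G :=
  (of.range.comap (MulAut.conj x).toMonoidHom).comap of

theorem mem_stab_iff {x : HNNExtension G A B φ} {g : G} :
    g ∈ stab x ↔ len (x * of g * x⁻¹) = 0 := by
  rw [len_eq_zero_iff]; rfl

theorem stab_t_zpow (u : ℤˣ) :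
    stab (t ^ (u : ℤ) : HNNExtension G A B φ) = toSubgroup A B u := by
  ext g
  rw [mem_stab_iff]
  exact ⟨mem_toSubgroup_of_t_zpow_conj, fun hg ↦
    len_eq_zero_iff.2 ⟨toSubgroupEquiv φ u ⟨g, hg⟩, (of_toSubgroupEquiv u ⟨g, hg⟩).symm⟩⟩

theorem stab_eq_map_of_eq (g g' : G) (u : ℤˣ) :
    stab (of g * (t ^ (u : ℤ) * of g') : HNNExtension G A B φ) =
      (toSubgroup A B u).map (MulAut.conj g'⁻¹).toMonoidHom := by
  ext k
  have h : of g * (t ^ (u : ℤ) * of g') * of k * (of g * (t ^ (u : ℤ) * of g'))⁻¹ =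
      of g * (t ^ (u : ℤ) * of (g' * k * g'⁻¹) * (t ^ (u : ℤ))⁻¹ : HNNExtension G A B φ) *
        of g⁻¹ := by
    simp [mul_assoc]
  rw [mem_stab_iff, h, len_mul_of, len_of_mul, ← mem_stab_iff, stab_t_zpow]
  constructor
  · intro hk
    exact ⟨_, hk, by simp [mul_assoc]⟩
  · rintro ⟨a, ha, rfl⟩
    simpa [mul_assoc] using ha

theorem card_toSubgroup (φ : A ≃* B) (u : ℤˣ) : Nat.card (toSubgroup A B u) = Nat.card A := by
  rcases Int.units_eq_one_or u with rfl | rfl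
  · rfl
  · exact (Nat.card_congr φ.toEquiv).symm

theorem finite_toSubgroup [Finite A] [Finite B] (u : ℤˣ) : Finite (toSubgroup A B u) := by
  rcases Int.units_eq_one_or u with rfl | rfl <;> simpa

theorem card_stab {x : HNNExtension G A B φ} (hx : len x = 1) :
    Nat.card (stab x) = Nat.card A := by
  obtain ⟨g, u, g', rfl⟩ := exists_eq_of_len_eq_one hx
  rw [stab_eq_map_of_eq, ← card_toSubgroup φ u]
  exact Subgroup.card_map_of_injective (MulAut.conj g'⁻¹).injective

theorem finite_stab [Finite A] [Finite B] {x : HNNExtension G A B φ} (hx : len x = 1) :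
    Finite (stab x) := by
  obtain ⟨g, u, g', rfl⟩ := exists_eq_of_len_eq_one hx
  rw [stab_eq_map_of_eq]
  have := finite_toSubgroup (A := A) (B := B) u
  exact Set.Finite.image _ (Set.toFinite (toSubgroup A B u : Set G))

/-- An element of `G` moving the vertex at the end of a nontrivial path from the base vertex by
less than twice the length of the path fixes the first edge of that path. -/
theorem exists_len_eq_one_of_len_ne_zero {a : HNNExtension G A B φ} (ha : len a ≠ 0) :
    ∃ z : HNNExtension G A B φ, len z = 1 ∧
      ∀ g, len (a * of g * a⁻¹) < 2 * len a → g ∈ stab z := by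
  obtain ⟨z, hz, hz'⟩ := exists_len_eq (x := a) (k := 1) (by omega)
  refine ⟨z, hz, fun g hg ↦ ?_⟩
  have h1 := len_mul_inv a z
  have h2 := len_mul_inv a (a * of g⁻¹)
  have h3 := len_mul_inv (a * of g⁻¹) (z * of g⁻¹)
  have h4 := len_mul_inv z (z * of g⁻¹)
  have e2 : a * (a * of g⁻¹)⁻¹ = a * of g * a⁻¹ := by simp [mul_assoc]
  have e3 : (a * of g⁻¹) * (z * of g⁻¹)⁻¹ = a * z⁻¹ := by simp [mul_assoc]
  have e4 : z * (z * of g⁻¹)⁻¹ = z * of g * z⁻¹ := by simp [mul_assoc]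
  rw [e2, len_mul_of] at h2
  rw [e3, len_mul_of, len_mul_of] at h3
  rw [e4, len_mul_of] at h4
  have h5 := min_common_le z a (a * of g⁻¹)
  have h6 := min_common_le z (a * of g⁻¹) (z * of g⁻¹)
  rw [common_comm z a] at h5
  rw [mem_stab_iff]
  omega

/-- An element which is not hyperbolic has exponent zero. -/
theorem exponent_eq_one_of_len_mul_self_le {s : HNNExtension G A B φ}
    (hs : len (s * s) ≤ len s) : exponent s = 1 := by
  obtain ⟨z, hz, hz'⟩ := exists_len_eq (x := s) (k := (len s + 1) / 2) (by omega)
  have h1 := len_mul_inv s z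
  have h2 := len_mul_inv s s⁻¹
  have h3 := len_mul_inv s⁻¹ z
  have h4 := len_mul_inv (z * s) s
  have h5 := len_mul_inv s⁻¹ (z * s⁻¹)
  have h6 := len_mul_inv (z * s) (z * s⁻¹)
  rw [inv_inv] at h2
  have e1 : len (s⁻¹ * z⁻¹) = len (z * s) := by rw [← mul_inv_rev, len_inv]
  have e2 : len (z * s⁻¹) = len (s * z⁻¹) := by rw [← len_inv]; simp
  have e3 : s⁻¹ * (z * s⁻¹)⁻¹ = z⁻¹ := by simp
  have e4 : z * s * (z * s⁻¹)⁻¹ = z * (s * s) * z⁻¹ := by simp [mul_assoc]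
  rw [e1, len_inv] at h3
  rw [mul_inv_cancel_right] at h4
  rw [e3, len_inv, len_inv, e2] at h5
  rw [e4, e2] at h6
  rw [len_inv] at h2
  have g1 := min_common_le s⁻¹ s z
  have g2 := min_common_le (z * s) s s⁻¹
  have g3 := min_common_le (z * s) s⁻¹ (z * s⁻¹)
  have g4 := common_le_left (z * s) s
  have g5 := common_le_right s⁻¹ z
  rw [common_comm s⁻¹ s] at g1
  obtain ⟨k, hk⟩ := len_eq_zero_iff.1 (show len (z * (s * s) * z⁻¹) = 0 by omega)
  have hk' := congrArg exponent hk
  simp only [exponent_of, map_mul, map_inv, mul_inv_cancel_comm] at hk'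
  have : exponent s ^ 2 = 1 := by rw [sq]; exact hk'.symm
  have h0 : 2 * Multiplicative.toAdd (exponent s) = 0 := by
    simpa using congrArg Multiplicative.toAdd this
  exact Multiplicative.toAdd.injective (by simpa using h0)

theorem exponent_ne_one_of_len_eq_one {x : HNNExtension G A B φ} (hx : len x = 1) :
    exponent x ≠ 1 := by
  obtain ⟨g, u, g', rfl⟩ := exists_eq_of_len_eq_one hx
  intro h
  have h' := congrArg Multiplicative.toAdd h
  rcases Int.units_eq_one_or u with rfl | rfl <;> simp at h'

/-! ### The Bass-Serre tree -/

theorem suffixGraph_range_letters_isTree :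
    (suffixGraph (Set.range (letters : HNNExtension G A B φ → _))).IsTree := by
  refine suffixGraph_isTree ⟨1, letters_one⟩ ?_
  rintro a l ⟨x, hx⟩
  obtain ⟨y, -, -, hy, -⟩ := exists_of_letters_eq_cons hx
  exact ⟨y, hy⟩

/-- The vertex of the Bass-Serre tree given by the coset of an element. -/
noncomputable def vertex (x : HNNExtension G A B φ) :
    Set.range (letters : HNNExtension G A B φ → _) :=
  ⟨letters x, x, rfl⟩

theorem vertex_surjective : Function.Surjective (vertex (φ := φ)) := by
  rintro ⟨_, x, rfl⟩
  exact ⟨x, rfl⟩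

theorem vertex_eq_iff {x y : HNNExtension G A B φ} :
    vertex x = vertex y ↔ ∃ g, x = of g * y := by
  refine ⟨fun h ↦ exists_eq_of_mul_of_letters_eq (congrArg Subtype.val h), ?_⟩
  rintro ⟨g, rfl⟩
  exact Subtype.ext (letters_of_mul g y)

theorem suffixGraph_adj_vertex_iff {x y : HNNExtension G A B φ} :
    (suffixGraph (Set.range letters)).Adj (vertex x) (vertex y) ↔ len (x * y⁻¹) = 1 := by
  constructor
  · have key (x y : HNNExtension G A B φ) {a : ℤˣ × G} (h : letters y = a :: letters x) :
        len (x * y⁻¹) = 1 := by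
      have h1 := len_mul_inv x y
      have h2 := common_le_left x y
      have h3 := (List.commonSuffixLength_cons_le (letters x) (letters x) a).1
      have h4 := congrArg List.length h
      rw [← h, List.commonSuffixLength_self, List.commonSuffixLength_comm] at h3
      rw [List.length_cons] at h4
      simp only [len, common] at h1 h2 ⊢
      omega
    rintro ⟨a, h | h⟩
    · exact key x y h
    · rw [← len_inv, mul_inv_rev, inv_inv]
      exact key y x h
  · intro h
    obtain ⟨g, u, g', hg⟩ := exists_eq_of_len_eq_one h
    obtain rfl : x = of g * (t ^ (u : ℤ) * (of g' * y)) := by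
      simpa only [mul_assoc] using mul_inv_eq_iff_eq_mul.1 hg
    have := letters_t_zpow_mul u (of g' * y)
    rw [letters_of_mul] at this
    simp only [suffixGraph, vertex, letters_of_mul]
    rcases this with ⟨a, h⟩ | ⟨a, h⟩
    · exact ⟨a, Or.inl h⟩
    · exact ⟨a, Or.inr h⟩

theorem vertex_mul_right {x y : HNNExtension G A B φ} (h : vertex x = vertex y)
    (z : HNNExtension G A B φ) : vertex (x * z) = vertex (y * z) := by
  obtain ⟨g, rfl⟩ := vertex_eq_iff.1 h
  exact vertex_eq_iff.2 ⟨g, mul_assoc _ _ _⟩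

/-- The action of an HNN-extension on its Bass-Serre tree. -/
noncomputable def treeAction :
    HNNExtension G A B φ →* Equiv.Perm (Set.range (letters : HNNExtension G A B φ → _)) :=
  MonoidHom.toHomPerm
    { toFun := fun x v ↦ vertex (Function.surjInv vertex_surjective v * x⁻¹)
      map_one' := by
        funext v
        change vertex (Function.surjInv vertex_surjective v * 1⁻¹) = v
        rw [inv_one, mul_one]
        exact Function.surjInv_eq vertex_surjective v
      map_mul' := fun x x' ↦ by
        funext v
        change vertex _ = vertex (Function.surjInv vertex_surjective (vertex _) * x⁻¹)
        rw [vertex_mul_right (Function.surjInv_eq vertex_surjective _), mul_inv_rev, mul_assoc] }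

theorem treeAction_vertex (x y : HNNExtension G A B φ) :
    treeAction x (vertex y) = vertex (y * x⁻¹) :=
  vertex_mul_right (Function.surjInv_eq vertex_surjective _) _

/-- A group with the tree fixed-point property embedded in an HNN-extension with finite associated
subgroups is conjugate into the base group. -/
theorem exists_conj_mem_of_treeFixedPointProperty [Countable G] [Finite A] [Finite B]
    {Γ : Type*} [Group Γ] (hΓ : TreeFixedPointProperty.{w} Γ) (j : Γ →* HNNExtension G A B φ)
    (hj : Function.Injective j) :
    ∃ x : HNNExtension G A B φ, ∀ g, ∃ k, x * j g * x⁻¹ = of k := by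
  have hfix {x y : HNNExtension G A B φ} (h : treeAction y (vertex x) = vertex x) :
      ∃ k, x * y * x⁻¹ = of k := by
    rw [treeAction_vertex, vertex_eq_iff] at h
    obtain ⟨k, hk⟩ := h
    refine ⟨k⁻¹, ?_⟩
    rw [mul_inv_eq_iff_eq_mul] at hk ⊢
    rw [mul_assoc] at hk
    rw [map_inv, eq_inv_mul_iff_mul_eq, ← hk]
  obtain ⟨v, hv⟩ := hΓ.exists_fixed suffixGraph_range_letters_isTree (treeAction.comp j)
    (fun g v v' h ↦ by
      obtain ⟨x, rfl⟩ := vertex_surjective v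
      obtain ⟨y, rfl⟩ := vertex_surjective v'
      rw [suffixGraph_adj_vertex_iff] at h
      simpa [treeAction_vertex, suffixGraph_adj_vertex_iff, mul_assoc] using h)
    (by
      rintro ⟨g, v, v', h, h1, h2⟩
      obtain ⟨x, rfl⟩ := vertex_surjective v
      obtain ⟨y, rfl⟩ := vertex_surjective v'
      rw [suffixGraph_adj_vertex_iff] at h
      refine exponent_ne_one_of_len_eq_one h ?_
      simp only [MonoidHom.comp_apply, treeAction_vertex, vertex_eq_iff] at h1 h2
      obtain ⟨k, hk⟩ := h1
      obtain ⟨k', hk'⟩ := h2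
      have h1 := congrArg (fun z ↦ Multiplicative.toAdd (exponent z)) hk
      have h2 := congrArg (fun z ↦ Multiplicative.toAdd (exponent z)) hk'
      refine Multiplicative.toAdd.injective ?_
      simp only [map_mul, map_inv, exponent_of, toAdd_mul, toAdd_inv, toAdd_one] at h1 h2 ⊢
      omega)
    (fun v v' h ↦ by
      obtain ⟨x, rfl⟩ := vertex_surjective v
      obtain ⟨y, rfl⟩ := vertex_surjective v'
      rw [suffixGraph_adj_vertex_iff] at h
      have hz : len (y * x⁻¹) = 1 := by rw [← len_inv]; simpa using h
      have := finite_stab hz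
      have hfin : (of '' (stab (y * x⁻¹) : Set G) : Set (HNNExtension G A B φ)).Finite :=
        (Set.toFinite _).image _
      refine (hfin.preimage (f := fun g ↦ x * j g * x⁻¹) ?_).subset ?_
      · intro g _ g' _ hg
        exact hj (by simpa using hg)
      · rintro g ⟨h1, h2⟩
        obtain ⟨k, hk⟩ := hfix h1
        obtain ⟨k', hk'⟩ := hfix h2
        refine ⟨k, mem_stab_iff.2 (len_eq_zero_iff.2 ⟨k', ?_⟩), hk.symm⟩
        rw [← hk, ← hk']
        simp [mul_assoc])
  obtain ⟨x, rfl⟩ := vertex_surjective v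
  exact ⟨x, fun g ↦ hfix (hv g)⟩

/-! ### Isomorphisms between HNN-extensions -/

/-- An element of positive length cannot conjugate an infinite base group into itself. -/
theorem len_eq_zero_of_conj_mem_of [Finite A] [Finite B] [Infinite G] {a : HNNExtension G A B φ}
    (ha : ∀ g : G, ∃ k : G, a * of g * a⁻¹ = of k) : len a = 0 := by
  by_contra h
  obtain ⟨z, hz, hz'⟩ := exists_len_eq_one_of_len_ne_zero h
  have := finite_stab hz
  have htop : stab z = ⊤ := by
    refine eq_top_iff.2 fun g _ ↦ hz' g ?_
    obtain ⟨k, hk⟩ := ha g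
    rw [len_eq_zero_iff.2 ⟨k, hk.symm⟩]
    omega
  rw [htop] at this
  exact not_finite_iff_infinite.2 ‹Infinite G› (Finite.of_equiv _ Subgroup.topEquiv.toEquiv)

/-- Every isomorphism of HNN-extensions of a group with the tree fixed-point property becomes, after
an inner automorphism, an isomorphism preserving the base group. -/
theorem exists_mulEquiv_apply_of [Countable G] [Finite A] [Finite B]
    (hG : TreeFixedPointProperty.{w} G) {ψ : A ≃* B}
    (Φ : HNNExtension G A B φ ≃* HNNExtension G A B ψ) :
    ∃ (Ψ : HNNExtension G A B φ ≃* HNNExtension G A B ψ) (α : G ≃* G),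
      ∀ g, Ψ (of g) = of (α g) := by
  obtain ⟨x, hx⟩ := exists_conj_mem_of_treeFixedPointProperty hG (Φ.toMonoidHom.comp of)
    (Φ.injective.comp (of_injective _))
  let Ψ := Φ.trans (MulAut.conj x)
  choose b hb using hx
  have hΨ (g : G) : Ψ (of g) = of (b g) := hb g
  let β : G →* G := MonoidHom.mk' b fun g h ↦ of_injective (φ := ψ) <| by simp [← hΨ]
  have hβ : Function.Injective β := fun g h hgh ↦
    of_injective (φ := φ) <| Ψ.injective <| by rw [hΨ, hΨ]; exact congrArg of hgh
  suffices hs : Function.Surjective β from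
    ⟨Ψ, MulEquiv.ofBijective β ⟨hβ, hs⟩, hΨ⟩
  cases finite_or_infinite G with
  | inl h => exact Finite.surjective_of_injective hβ
  | inr h =>
    obtain ⟨y, hy⟩ := exists_conj_mem_of_treeFixedPointProperty hG (Ψ.symm.toMonoidHom.comp of)
      (Ψ.symm.injective.comp (of_injective _))
    have hy' (g : G) : ∃ k, Ψ y * of g * (Ψ y)⁻¹ = of (β k) := by
      obtain ⟨k, hk⟩ := hy g
      refine ⟨k, ?_⟩
      have := congrArg Ψ hk
      change _ = of (b k)
      simpa [hΨ] using this
    obtain ⟨c, hc⟩ := len_eq_zero_iff.1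
      (len_eq_zero_of_conj_mem_of fun g ↦ (hy' g).imp' β fun k hk ↦ hk)
    intro g
    obtain ⟨k, hk⟩ := hy' (c⁻¹ * g * c)
    refine ⟨k, of_injective (φ := ψ) ?_⟩
    rw [← hk, ← hc]
    simp [mul_assoc]

section

variable {ψ : A ≃* B} {Ψ : HNNExtension G A B φ ≃* HNNExtension G A B ψ} {α : G ≃* G}

theorem len_apply_t_zpow (u : ℤˣ) : len (Ψ t ^ (u : ℤ)) = len (Ψ t) := by
  rcases Int.units_eq_one_or u with rfl | rfl
  · simp
  · simp [len_inv]

theorem exponent_apply_t_ne_one (hΨ : ∀ g, Ψ (of g) = of (α g)) : exponent (Ψ t) ≠ 1 := by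
  intro h
  have h1 : (exponent (φ := ψ)).comp Ψ.toMonoidHom = 1 := by
    refine hom_ext ?_ (by simpa using h)
    ext g
    simp [hΨ]
  have h2 := DFunLike.congr_fun h1 (Ψ.symm t)
  simp [Multiplicative.ext_iff] at h2

theorem len_apply_t_ne_zero (hΨ : ∀ g, Ψ (of g) = of (α g)) : len (Ψ t) ≠ 0 := by
  intro h
  obtain ⟨g, hg⟩ := len_eq_zero_iff.1 h
  refine exponent_apply_t_ne_one hΨ ?_
  rw [← hg, exponent_of]

theorem lt_len_apply_t_zpow_mul [Finite A] [Finite B] (hΨ : ∀ g, Ψ (of g) = of (α g))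
    {u u' : ℤˣ} {g : G} (h : g ∈ toSubgroup A B u → u = u') :
    len (Ψ t) < len (Ψ t ^ (u : ℤ) * of (α g) * Ψ t ^ (u' : ℤ)) := by
  by_contra! hle
  by_cases huu : u = u'
  · subst huu
    have h1 : len (Ψ t ^ (u : ℤ) * of (α g)) = len (Ψ t) := by rw [len_mul_of, len_apply_t_zpow]
    have h2 := exponent_eq_one_of_len_mul_self_le (s := Ψ t ^ (u : ℤ) * of (α g)) <| by
      rwa [h1, ← mul_assoc, len_mul_of]
    refine exponent_apply_t_ne_one hΨ ?_
    rcases Int.units_eq_one_or u with rfl | rfl <;> simpa using h2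
  · obtain rfl : u' = -u := by
      rcases Int.units_eq_one_or u with rfl | rfl <;>
        rcases Int.units_eq_one_or u' with rfl | rfl <;> simp_all
    have hinv : Ψ t ^ ((-u : ℤˣ) : ℤ) = (Ψ t ^ (u : ℤ))⁻¹ := by simp
    rw [hinv] at hle
    have h0 := len_apply_t_ne_zero hΨ
    have hl := len_apply_t_zpow (Ψ := Ψ) u
    obtain ⟨z, hz, hz'⟩ := exists_len_eq_one_of_len_ne_zero (a := Ψ t ^ (u : ℤ)) (by omega)
    have h1 : α g ∈ stab z := hz' _ (by omega)
    have h2 : (toSubgroup A B u).map α.toMonoidHom ≤ stab (Ψ t ^ (u : ℤ)) := by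
      rintro _ ⟨a, ha, rfl⟩
      rw [mem_stab_iff]
      refine len_eq_zero_iff.2 ⟨α (toSubgroupEquiv φ u ⟨a, ha⟩), ?_⟩
      rw [← hΨ, ← of_toSubgroupEquiv]
      simp [hΨ]
    have h3 : stab (Ψ t ^ (u : ℤ)) ≤ stab z := fun k hk ↦ hz' k <| by
      rw [mem_stab_iff.1 hk]; omega
    have := finite_stab hz
    have h4 : (toSubgroup A B u).map α.toMonoidHom = stab z := by
      refine Subgroup.eq_of_le_of_card_ge (h2.trans h3) ?_
      rw [card_stab hz, ← card_toSubgroup φ u]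
      exact (Subgroup.card_map_of_injective α.injective).ge
    rw [← h4] at h1
    obtain ⟨k, hk, hkg⟩ := h1
    obtain rfl : k = g := α.injective hkg
    exact huu (h hk)

theorem len_lt_and_le_of_isChain [Finite A] [Finite B] (hΨ : ∀ g, Ψ (of g) = of (α g))
    (p : ℤˣ × G) (L : List (ℤˣ × G))
    (hL : (p :: L).IsChain (fun a b ↦ a.2 ∈ toSubgroup A B a.1 → a.1 = b.1)) :
    len (Ψ (L.map fun x ↦ t ^ (x.1 : ℤ) * of x.2).prod) <
        len (Ψ ((p :: L).map fun x ↦ t ^ (x.1 : ℤ) * of x.2).prod) ∧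
      len (Ψ t) ≤ len (Ψ ((p :: L).map fun x ↦ t ^ (x.1 : ℤ) * of x.2).prod) := by
  induction L generalizing p with
  | nil =>
    have h0 := len_apply_t_ne_zero hΨ
    have h1 : len (1 : HNNExtension G A B ψ) = 0 := len_eq_zero_iff.2 ⟨1, map_one _⟩
    simp [hΨ, len_mul_of, len_apply_t_zpow, h1]
    omega
  | cons q L ih =>
    rw [List.isChain_cons_cons] at hL
    obtain ⟨ih1, ih2⟩ := ih q hL.2
    obtain ⟨u, g⟩ := p
    obtain ⟨u', g'⟩ := q
    have key := lt_len_apply_t_zpow_mul hΨ hL.1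
    simp only [List.map_cons, List.prod_cons, map_mul, map_zpow, hΨ] at ih1 ih2 key ⊢
    generalize Ψ (L.map fun x ↦ t ^ (x.1 : ℤ) * of x.2).prod = X at *
    have hu := len_apply_t_zpow (Ψ := Ψ) u
    have hu' := len_apply_t_zpow (Ψ := Ψ) u'
    generalize Ψ t ^ (u : ℤ) = s at *
    generalize Ψ t ^ (u' : ℤ) = s' at *
    generalize len (Ψ t) = n at *
    have m1 := len_mul_inv s (of (α g) * s')⁻¹
    have m2 := len_mul_inv (of (α g) * (s' * of (α g') * X))⁻¹ (of (α g) * s')⁻¹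
    have m3 := len_mul_inv s (of (α g) * (s' * of (α g') * X))⁻¹
    have e2 : (of (α g) * (s' * of (α g') * X))⁻¹ * (of (α g) * s')⁻¹⁻¹ =
      (of (α g') * X)⁻¹ := by simp [mul_assoc]
    rw [e2] at m2
    rw [inv_inv, ← mul_assoc] at m1 m3
    simp only [len_inv, len_of_mul] at m1 m2 m3
    have m4 := min_common_le s (of (α g) * (s' * of (α g') * X))⁻¹ (of (α g) * s')⁻¹
    omega

theorem len_apply_t_eq_one [Finite A] [Finite B] (hΨ : ∀ g, Ψ (of g) = of (α g)) :
    len (Ψ t) = 1 := by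
  set d := Classical.arbitrary (TransversalPair G A B)
  have hw : (Ψ.symm t • (empty : NormalWord d)).prod φ = Ψ.symm t := by simp
  generalize Ψ.symm t • (empty : NormalWord d) = w at hw
  have hw' : t = of (α w.head) * Ψ (w.toList.map fun x ↦ t ^ (x.1 : ℤ) * of x.2).prod := by
    rw [← hΨ, ← map_mul]
    exact (Ψ.symm_apply_eq.1 hw.symm)
  have h1 : len (t : HNNExtension G A B ψ) = 1 := by simpa using len_t_zpow (φ := ψ) 1
  rw [hw', len_of_mul] at h1
  have h0 := len_apply_t_ne_zero hΨ
  have hc := w.chain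
  cases hl : w.toList with
  | nil =>
    rw [hl, List.map_nil, List.prod_nil, map_one, len_eq_zero_iff.2 ⟨1, map_one _⟩] at h1
    omega
  | cons p L =>
    rw [hl] at h1 hc
    have := (len_lt_and_le_of_isChain hΨ p L hc).2
    omega

end

/-- The isomorphism of HNN-extensions induced by an automorphism of the base group and a change of
stable letter preserving its orientation. -/
theorem nonempty_mulEquiv_gammaPerm (f : A ≃* B) (g : G) (α : G ≃* G)
    (hα : ∀ x : G, x ∈ A ↔ α x ∈ A) (hB : ∀ x : G, x ∈ B ↔ g * α x * g⁻¹ ∈ B) :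
    Nonempty (HNNExtension G A B f ≃* HNNExtension G A B (gammaPerm A B g α hα hB f)) := by
  set f' := gammaPerm A B g α hα hB f
  have h1 (a : A) : (f' ⟨α a, (hα a).1 a.2⟩ : G) = g * α (f a) * g⁻¹ := by
    have : (restrAut A α hα).symm ⟨α a, (hα a).1 a.2⟩ = a :=
      (restrAut A α hα).symm_apply_apply a
    change g * α (f ((restrAut A α hα).symm _)) * g⁻¹ = _
    rw [this]
  let F : HNNExtension G A B f →* HNNExtension G A B f' :=
    lift (of.comp α.toMonoidHom) (of g⁻¹ * t) fun a ↦ by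
      have := t_mul_of (φ := f') ⟨α a, (hα a).1 a.2⟩
      simp only [h1] at this
      simp [mul_assoc, this]
  let F' : HNNExtension G A B f' →* HNNExtension G A B f :=
    lift (of.comp α.symm.toMonoidHom) (of (α.symm g) * t) fun a ↦ by
      obtain ⟨a, rfl⟩ := (restrAut A α hα).surjective a
      have h2 : (f' (restrAut A α hα a) : G) = g * α (f a) * g⁻¹ := h1 a
      have h3 : ((restrAut A α hα a : A) : G) = α a := rfl
      have := t_mul_of (φ := f) a
      simp [mul_assoc, this, h2, h3]
  refine ⟨MonoidHom.toMulEquiv F F' (hom_ext ?_ ?_) (hom_ext ?_ ?_)⟩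
  · ext x; simp [F, F']
  · simp [F, F']
  · ext x; simp [F, F']
  · simp [F, F']

/-- The isomorphism of HNN-extensions induced by an automorphism of the base group and a change of
stable letter reversing its orientation. -/
theorem nonempty_mulEquiv_iotaPerm (f : A ≃* B) (ψ : G ≃* G) (g : G)
    (h1 : ∀ x : G, x ∈ A ↔ ψ x ∈ B) (h2 : ∀ x : G, x ∈ B ↔ g * ψ x * g⁻¹ ∈ A) :
    Nonempty (HNNExtension G A B f ≃* HNNExtension G A B (iotaPerm A B ψ g h1 h2 f)) := by
  set f' := iotaPerm A B ψ g h1 h2 f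
  have h3 (a : A) : (f' a : G) = ψ.symm (g⁻¹ * f.symm ⟨ψ a, (h1 a).1 a.2⟩ * g) := rfl
  let F' : HNNExtension G A B f' →* HNNExtension G A B f :=
    lift (of.comp ψ.toMonoidHom) (of g⁻¹ * t⁻¹) fun a ↦ by
      have := inv_t_mul_of (φ := f) ⟨ψ a, (h1 a).1 a.2⟩
      simp [h3, mul_assoc, this]
  let F : HNNExtension G A B f →* HNNExtension G A B f' :=
    lift (of.comp ψ.symm.toMonoidHom) (t⁻¹ * of (ψ.symm g⁻¹)) fun a ↦ by
      obtain ⟨a, rfl⟩ := ((restrMap A B ψ h1).trans f.symm).surjective a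
      have h4 : ((restrMap A B ψ h1 a : B) : G) = ψ a := rfl
      have h5 : (f' a : G) = ψ.symm (g⁻¹ * f.symm (restrMap A B ψ h1 a) * g) := rfl
      have h6 := of_mul_inv_t (φ := f') a
      rw [h5] at h6
      simp only [MulEquiv.trans_apply, MulEquiv.apply_symm_apply, h4]
      simp [← mul_assoc, h6]
  refine ⟨MonoidHom.toMulEquiv F F' (hom_ext ?_ ?_) (hom_ext ?_ ?_)⟩
  · ext x; simp [F, F']
  · simp [F, F']
  · ext x; simp [F, F']
  · simp [F, F']

theorem nonempty_mulEquiv_of_mem_gammaBar {σ : Equiv.Perm (A ≃* B)} (hσ : σ ∈ gammaBar A B)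
    (f : A ≃* B) : Nonempty (HNNExtension G A B f ≃* HNNExtension G A B (σ f)) := by
  induction hσ using Subgroup.closure_induction generalizing f with
  | mem σ hσ =>
    rcases hσ with ⟨g, α, hα, hB, rfl⟩ | ⟨ψ, g, h1, h2, rfl⟩
    · exact nonempty_mulEquiv_gammaPerm f g α hα hB
    · exact nonempty_mulEquiv_iotaPerm f ψ g h1 h2
  | one => exact ⟨MulEquiv.refl _⟩
  | mul σ τ _ _ hσ hτ =>
    obtain ⟨e⟩ := hτ f
    obtain ⟨e'⟩ := hσ (τ f)
    exact ⟨e.trans e'⟩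
  | inv σ _ hσ =>
    obtain ⟨e⟩ := hσ (σ⁻¹ f)
    rw [← Equiv.Perm.mul_apply, mul_inv_cancel, Equiv.Perm.one_apply] at e
    exact ⟨e.symm⟩

theorem mem_iff_of_mapsTo {S T : Subgroup G} [Finite S] [Finite T] (hST : Nat.card S = Nat.card T)
    (β : G ≃* G) (h : ∀ x ∈ S, β x ∈ T) (x : G) : x ∈ S ↔ β x ∈ T := by
  have h1 : S.map β.toMonoidHom = T := by
    refine Subgroup.eq_of_le_of_card_ge ?_ ?_
    · rintro _ ⟨x, hx, rfl⟩
      exact h x hx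
    · rw [← hST]
      exact (Subgroup.card_map_of_injective β.injective).ge
  refine ⟨h x, fun hx ↦ ?_⟩
  rw [← h1] at hx
  obtain ⟨y, hy, hyx⟩ := hx
  rwa [← β.injective hyx]

theorem exists_mem_gammaBar_of_mulEquiv [Finite A] [Finite B] {f f' : A ≃* B}
    (Ψ : HNNExtension G A B f ≃* HNNExtension G A B f') (α : G ≃* G)
    (hΨ : ∀ g, Ψ (of g) = of (α g)) : ∃ σ ∈ gammaBar A B, σ f = f' := by
  obtain ⟨g, u, g', hg⟩ := exists_eq_of_len_eq_one (len_apply_t_eq_one hΨ)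
  have hcard : Nat.card A = Nat.card B := Nat.card_congr f.toEquiv
  let β : G ≃* G := α.trans (MulAut.conj g')
  have hβ (x : G) : β x = g' * α x * g'⁻¹ := rfl
  set γ := g' * g with hγ
  have key (a : A) :
      t ^ (u : ℤ) * of (β a) * (t ^ (u : ℤ))⁻¹ =
        (of (γ⁻¹ * β (f a) * γ) : HNNExtension G A B f') := by
    have h1 := congrArg Ψ (equiv_eq_conj (φ := f) a)
    simp only [map_mul, map_inv, hΨ, hg] at h1
    simp [hβ, hγ, h1, mul_assoc]
  have hmem (a : A) : β a ∈ toSubgroup A B u :=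
    mem_toSubgroup_of_t_zpow_conj (φ := f') (len_eq_zero_iff.2 ⟨_, (key a).symm⟩)
  have key' (a : A) : (toSubgroupEquiv f' u ⟨β a, hmem a⟩ : G) = γ⁻¹ * β (f a) * γ := by
    apply of_injective (φ := f')
    rw [← key, ← of_toSubgroupEquiv]
  rcases Int.units_eq_one_or u with rfl | rfl
  · have h1 := mem_iff_of_mapsTo rfl β fun x hx ↦ hmem ⟨x, hx⟩
    have h2 : ∀ x, x ∈ B ↔ γ⁻¹ * β x * γ⁻¹⁻¹ ∈ B :=
      mem_iff_of_mapsTo rfl (β.trans (MulAut.conj γ⁻¹)) fun x hx ↦ by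
        have := key' (f.symm ⟨x, hx⟩)
        rw [f.apply_symm_apply] at this
        change γ⁻¹ * β x * γ⁻¹⁻¹ ∈ B
        rw [inv_inv, ← this]
        exact SetLike.coe_mem _
    refine ⟨gammaPerm A B γ⁻¹ β h1 h2,
      Subgroup.subset_closure (.inl ⟨γ⁻¹, β, h1, h2, rfl⟩), ?_⟩
    ext a
    obtain ⟨a, rfl⟩ := (restrAut A β h1).surjective a
    have h3 := key' a
    change (γ⁻¹ * β (f ((restrAut A β h1).symm (restrAut A β h1 a))) * γ⁻¹⁻¹ : G) =
      f' (restrAut A β h1 a)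
    rw [MulEquiv.symm_apply_apply, inv_inv, ← h3]
    rfl
  · have h1 := mem_iff_of_mapsTo hcard β fun x hx ↦ hmem ⟨x, hx⟩
    have h2 : ∀ x, x ∈ B ↔ γ⁻¹ * β x * γ⁻¹⁻¹ ∈ A :=
      mem_iff_of_mapsTo hcard.symm (β.trans (MulAut.conj γ⁻¹)) fun x hx ↦ by
        have := key' (f.symm ⟨x, hx⟩)
        rw [f.apply_symm_apply] at this
        change γ⁻¹ * β x * γ⁻¹⁻¹ ∈ A
        rw [inv_inv, ← this]
        exact SetLike.coe_mem _
    refine ⟨(iotaPerm A B β γ⁻¹ h1 h2)⁻¹,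
      inv_mem (Subgroup.subset_closure (.inr ⟨β, γ⁻¹, h1, h2, rfl⟩)), ?_⟩
    rw [Equiv.Perm.inv_eq_iff_eq]
    ext a
    have h3 : (f'.symm ⟨β a, hmem a⟩ : G) = γ⁻¹ * β (f a) * γ := key' a
    change (f a : G) = β.symm (γ⁻¹⁻¹ * (f'.symm ⟨β a, hmem a⟩ : G) * γ⁻¹)
    rw [h3]
    simp [mul_assoc]

end HNNExtension

/-- For an OE-group `G₁` and finite subgroups `H`, `K`, the HNN-extensions
`HNN(G₁,H,K,f)` and `HNN(G₁,H,K,f₁)` are isomorphic if and only if `f` and `f₁` lie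
in the same `Γ̄_{HK}`-orbit of `Iso(H,K)`. -/
theorem hnn_iso_iff_gammaBar_orbit {G₁ : Type u} [Group G₁] (hOE : IsOEGroup.{w} G₁)
    (H K : Subgroup G₁) [Finite H] [Finite K] (f f₁ : H ≃* K) :
    Nonempty (HNNExtension G₁ H K f ≃* HNNExtension G₁ H K f₁) ↔
      ∃ σ ∈ gammaBar H K, σ f = f₁ := by
  constructor
  · rintro ⟨Φ⟩
    have := hOE.1.countable
    obtain ⟨Ψ, α, hΨ⟩ := HNNExtension.exists_mulEquiv_apply_of hOE.2.2 Φ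
    exact HNNExtension.exists_mem_gammaBar_of_mulEquiv Ψ α hΨ
  · rintro ⟨σ, hσ, rfl⟩
    exact HNNExtension.nonempty_mulEquiv_of_mem_gammaBar hσ f
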